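/- arXiv:math/0512570 — 5 statements merged into one kernel-verified Lean document; each statement's English description precedes it below -/
import Mathlib

section
/- For every integer n ≥ 1, the number of parking functions of length n is (n+1)^{n−1}, i.e. |PF_n| = (n+1)^{n−1}. -/
open Finset

open scoped Classical in
/-- The set of parking functions of length `n`, encoded as functions
`f : Fin n → Fin n`, where `f j` represents the letter `(f j : ℕ) + 1 ∈ {1,…,n}`.
The defining condition is that the nondecreasing rearrangement
`f ∘ Tuple.sort f` satisfies `a↑ᵢ ≤ i` (with 1-based indexing). -/
noncomputable def PFset (n : ℕ) : Finset (Fin n → Fin n) :=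
  Finset.univ.filter fun f =>
    ∀ i : Fin n, ((f ∘ Tuple.sort f) i : ℕ) + 1 ≤ (i : ℕ) + 1

/-- The number of letters of `f` that are smaller than `k`. -/
def countLT {n : ℕ} (f : Fin n → ℕ) (k : ℕ) : ℕ := #{i | f i < k}

/-- The counting form of the parking condition, for words with letters starting at `0`. -/
def IsParking {n : ℕ} (f : Fin n → ℕ) : Prop := ∀ k ≤ n, k ≤ countLT f k

theorem countLT_comp_perm {n : ℕ} (f : Fin n → ℕ) (σ : Equiv.Perm (Fin n)) (k : ℕ) :
    countLT (f ∘ σ) k = countLT f k :=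
  card_equiv σ (by simp)

theorem isParking_iff_of_monotone {n : ℕ} {g : Fin n → ℕ} (hg : Monotone g) :
    IsParking g ↔ ∀ i, g i ≤ i := by
  constructor
  · intro h i
    by_contra! hi
    have hk := h (i + 1) i.2
    have hsub : ({j | g j < (i : ℕ) + 1} : Finset (Fin n)) ⊆ Finset.Iio i := by
      intro j hj
      simp only [mem_filter, mem_univ, true_and, Finset.mem_Iio] at hj ⊢
      by_contra! hij
      have := hg hij
      omega
    have hcard := card_le_card hsub
    rw [Fin.card_Iio] at hcard
    unfold countLT at hk
    omega
  · intro h k hk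
    have hsub : (univ.map (Fin.castLEEmb hk)) ⊆ ({j | g j < k} : Finset (Fin n)) := by
      intro j hj
      obtain ⟨i, -, rfl⟩ := Finset.mem_map.1 hj
      have := h (Fin.castLEEmb hk i)
      simp only [mem_filter, mem_univ, true_and]
      exact this.trans_lt i.2
    simpa [countLT] using card_le_card hsub

theorem mem_PFset_iff {n : ℕ} (f : Fin n → Fin n) :
    f ∈ PFset n ↔ IsParking fun i => (f i : ℕ) := by
  have hmono : Monotone ((fun i => (f i : ℕ)) ∘ Tuple.sort f) :=
    fun _ _ hij => Tuple.monotone_sort f hij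
  have h := isParking_iff_of_monotone hmono
  simp only [IsParking, countLT_comp_perm] at h
  simpa [PFset, IsParking] using h.symm

theorem val_sub_eq_ite {n : ℕ} (a c : Fin (n + 1)) :
    ((a - c : Fin (n + 1)) : ℕ) = if (c : ℕ) ≤ a then (a : ℕ) - c else a + (n + 1) - c := by
  split_ifs with h
  · exact Fin.sub_val_of_le h
  · exact (Fin.coe_sub_iff_lt.2 (by simpa using h)).trans (by omega)

theorem countLT_sub_add {n : ℕ} (f : Fin n → Fin (n + 1)) (c : Fin (n + 1)) {k : ℕ}
    (hk : c + k ≤ n + 1) :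
    countLT (fun i => ((f i - c : Fin (n + 1)) : ℕ)) k + countLT (fun i => (f i : ℕ)) c =
      countLT (fun i => (f i : ℕ)) (c + k) := by
  unfold countLT
  rw [← card_union_of_disjoint]
  · congr 1
    ext i
    simp only [mem_union, mem_filter, mem_univ, true_and, val_sub_eq_ite]
    split_ifs <;> omega
  · rw [disjoint_filter]
    intro i _
    beta_reduce
    rw [val_sub_eq_ite]
    split_ifs <;> omega

theorem countLT_sub_add_of_lt {n : ℕ} (f : Fin n → Fin (n + 1)) (c : Fin (n + 1)) {j : ℕ}
    (hj : j < c) :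
    countLT (fun i => ((f i - c : Fin (n + 1)) : ℕ)) (j + (n + 1) - c) +
      countLT (fun i => (f i : ℕ)) c = n + countLT (fun i => (f i : ℕ)) j := by
  unfold countLT
  have hc := c.2
  have hun : ({i | ((f i - c : Fin (n + 1)) : ℕ) < j + (n + 1) - c} : Finset (Fin n)) ∪
      ({i | (f i : ℕ) < c} : Finset (Fin n)) = univ := by
    ext i
    have := (f i).2
    simp only [mem_union, mem_filter, mem_univ, true_and, val_sub_eq_ite, iff_true]
    split_ifs <;> omega
  have hin : ({i | ((f i - c : Fin (n + 1)) : ℕ) < j + (n + 1) - c} : Finset (Fin n)) ∩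
      ({i | (f i : ℕ) < c} : Finset (Fin n)) = ({i | (f i : ℕ) < j} : Finset (Fin n)) := by
    ext i
    have := (f i).2
    simp only [mem_inter, mem_filter, mem_univ, true_and, val_sub_eq_ite]
    split_ifs <;> omega
  rw [← card_union_add_card_inter, hun, hin, card_fin]

theorem isParking_sub_iff {n : ℕ} (f : Fin n → Fin (n + 1)) (c : Fin (n + 1)) :
    IsParking (fun i => ((f i - c : Fin (n + 1)) : ℕ)) ↔
      ∀ j : Fin (n + 1),
        (c ≤ j → countLT (fun i => (f i : ℕ)) c + j ≤ countLT (fun i => (f i : ℕ)) j + c) ∧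
        (j < c → countLT (fun i => (f i : ℕ)) c + j < countLT (fun i => (f i : ℕ)) j + c) := by
  have hc := c.2
  constructor
  · intro h j
    have hj := j.2
    refine ⟨fun hcj => ?_, fun hjc => ?_⟩
    · rw [Fin.le_def] at hcj
      have h1 := h (j - c) (by omega)
      have h2 := countLT_sub_add f c (k := j - c) (by omega)
      rw [Nat.add_sub_cancel' hcj] at h2
      omega
    · rw [Fin.lt_def] at hjc
      have h1 := h (j + (n + 1) - c) (by omega)
      have h2 := countLT_sub_add_of_lt f c hjc
      omega
  · intro h k hk
    by_cases hck : (c : ℕ) + k ≤ n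
    · have h1 := (h ⟨c + k, by omega⟩).1 (by simp [Fin.le_def])
      have h2 := countLT_sub_add f c (k := k) (by omega)
      simp only at h1
      omega
    · obtain ⟨j, hj⟩ : ∃ j, c + k = j + (n + 1) := ⟨c + k - (n + 1), by omega⟩
      have hjc : j < c := by omega
      have h1 := (h ⟨j, by omega⟩).2 (by simpa [Fin.lt_def] using hjc)
      have h2 := countLT_sub_add_of_lt f c hjc
      rw [show j + (n + 1) - (c : ℕ) = k by omega] at h2
      simp only at h1
      omega

/-- Every word over `ℤ/(n+1)` of length `n` has exactly one parking translate. -/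
theorem existsUnique_isParking_sub {n : ℕ} (f : Fin n → Fin (n + 1)) :
    ∃! c : Fin (n + 1), IsParking fun i => ((f i - c : Fin (n + 1)) : ℕ) := by
  simp only [isParking_sub_iff]
  obtain ⟨c, hc⟩ := Finite.exists_min fun j : Fin (n + 1) =>
    toLex ((countLT (fun i => (f i : ℕ)) j : ℤ) - j, j)
  refine ⟨c, fun j => ?_, fun d hd => ?_⟩
  · have h := hc j
    rw [Prod.Lex.toLex_le_toLex] at h
    simp only [Fin.le_def, Fin.lt_def] at h ⊢
    omega
  · rcases lt_trichotomy c d with h | h | h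
    · have h1 := (hd c).2 h
      have h2 := hc d
      rw [Prod.Lex.toLex_le_toLex] at h2
      simp only at h2
      omega
    · exact h.symm
    · have h1 := (hd c).1 h.le
      have h2 := hc d
      rw [Prod.Lex.toLex_le_toLex] at h2
      simp only [Fin.le_def, Fin.lt_def] at h h2
      omega

theorem IsParking.lt {n : ℕ} {f : Fin n → ℕ} (h : IsParking f) (i : Fin n) : f i < n := by
  have hcard : countLT f n = n := le_antisymm (card_finset_fin_le _) (h n le_rfl)
  have huniv : ({i | f i < n} : Finset (Fin n)) = univ := by
    rw [← card_eq_iff_eq_univ, Fintype.card_fin]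
    exact hcard
  simpa using Finset.ext_iff.1 huniv i

theorem bijective_translate (n : ℕ) :
    Function.Bijective fun p : PFset n × Fin (n + 1) => fun i => (p.1.1 i).castSucc + p.2 := by
  have key (a : PFset n) (c : Fin (n + 1)) :
      IsParking fun i => (((a.1 i).castSucc + c - c : Fin (n + 1)) : ℕ) := by
    simpa using (mem_PFset_iff a.1).1 a.2
  constructor
  · rintro ⟨a, c⟩ ⟨b, d⟩ hab
    have hb := key b d
    have hfun (i : Fin n) : (a.1 i).castSucc + c = (b.1 i).castSucc + d := congrFun hab i
    simp only [← hfun] at hb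
    obtain rfl := (existsUnique_isParking_sub _).unique (key a c) hb
    refine Prod.ext (Subtype.ext (funext fun i => ?_)) rfl
    exact Fin.castSucc_injective n (add_right_cancel (hfun i))
  · intro f
    obtain ⟨c, hc, -⟩ := existsUnique_isParking_sub f
    refine ⟨(⟨fun i => ⟨_, hc.lt i⟩, (mem_PFset_iff _).2 hc⟩, c), funext fun i => ?_⟩
    exact sub_add_cancel (f i) c

theorem stmt2 (n : ℕ) (hn : 1 ≤ n) : (PFset n).card = (n + 1) ^ (n - 1) := by
  have h := Fintype.card_of_bijective (bijective_translate n)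
  simp only [Fintype.card_prod, Fintype.card_coe, Fintype.card_fin, Fintype.card_fun] at h
  obtain ⟨m, rfl⟩ := Nat.exists_eq_add_of_le' hn
  rw [pow_succ (m + 1 + 1) m] at h
  exact Nat.eq_of_mul_eq_mul_right (Nat.succ_pos _) h
end

section
/- For every composition I of n ≥ 1, the number of nondecreasing parking functions of length n with packed evaluation I equals the number of nondecreasing parking functions of length n with packed evaluation the conjugate composition I∼. (Consequently, there is an involution on NDPF_n sending the fibers of the packed evaluation map over I bijectively onto those over I∼.) -/
open Finset

open scoped Classical in
/-- The set of nondecreasing parking functions of length `n`, encoded as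
monotone functions `f : Fin n → Fin n`, where `f j` represents the letter
`(f j : ℕ) + 1 ∈ {1,…,n}`; the parking condition `bᵢ ≤ i` (1-based) reads
`(f i : ℕ) ≤ i`. -/
noncomputable def NDPFset (n : ℕ) : Finset (Fin n → Fin n) :=
  Finset.univ.filter fun f =>
    Monotone f ∧ ∀ i : Fin n, (f i : ℕ) + 1 ≤ (i : ℕ) + 1

open scoped Classical in
/-- The packed evaluation of a word `f : Fin n → Fin n`: the list of numbers of
occurrences of each letter, in increasing order of the letters, with zero
entries removed. -/
noncomputable def pEv {n : ℕ} (f : Fin n → Fin n) : List ℕ :=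
  ((List.range n).map fun a =>
      (Finset.univ.filter fun j => (f j : ℕ) = a).card).filter (· ≠ 0)

/-- The descent set `D(I) = {i₁, i₁+i₂, …, i₁+⋯+i_{p-1}} ⊆ {1,…,n-1}` of a
composition `I = (i₁,…,i_p)` of `n`. -/
def descents {n : ℕ} (I : Composition n) : Finset ℕ :=
  (Finset.range (I.length - 1)).image fun j => (I.blocks.take (j + 1)).sum

/-- The positions `i ∈ {1,…,n-1}` at which the word `F 0, …, F (n-1)` changes letter. -/
def changeSet (n : ℕ) (F : ℕ → ℕ) : Finset ℕ :=
  {i ∈ Finset.Icc 1 (n - 1) | F (i - 1) ≠ F i}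

/-- The subsets of `{1,…,n-1}` of the same size as `D` which are below `D` in the Gale order. -/
def galeBelow (n : ℕ) (D : Finset ℕ) : Finset (Finset ℕ) :=
  {X ∈ (Finset.Icc 1 (n - 1)).powerset | X.card = D.card ∧
    ∀ m ≤ n, Nat.count (· ∈ D) m ≤ Nat.count (· ∈ X) m}

/-- The reversed complement of a subset of `{1,…,n-1}`. -/
def reverseCompl (n : ℕ) (D : Finset ℕ) : Finset ℕ :=
  ((Finset.Icc 1 (n - 1)) \ D).image fun d => n - d

lemma mem_reverseCompl {n x : ℕ} {D : Finset ℕ} :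
    x ∈ reverseCompl n D ↔ x ∈ Finset.Icc 1 (n - 1) ∧ n - x ∉ D := by
  simp only [reverseCompl, Finset.mem_image, Finset.mem_sdiff, Finset.mem_Icc]
  constructor
  · rintro ⟨d, ⟨h, hd⟩, rfl⟩
    refine ⟨by omega, ?_⟩
    rwa [show n - (n - d) = d by omega]
  · rintro ⟨h, hd⟩
    exact ⟨n - x, ⟨by omega, hd⟩, by omega⟩

lemma reverseCompl_subset (n : ℕ) (D : Finset ℕ) :
    reverseCompl n D ⊆ Finset.Icc 1 (n - 1) :=
  fun _ h => (mem_reverseCompl.1 h).1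

lemma reverseCompl_reverseCompl {n : ℕ} {D : Finset ℕ} (hD : D ⊆ Finset.Icc 1 (n - 1)) :
    reverseCompl n (reverseCompl n D) = D := by
  ext x
  simp only [mem_reverseCompl, Finset.mem_Icc]
  constructor
  · rintro ⟨h, h'⟩
    by_contra hx
    exact h' ⟨by omega, by rwa [show n - (n - x) = x by omega]⟩
  · intro hx
    have := Finset.mem_Icc.1 (hD hx)
    refine ⟨this, fun h => h.2 ?_⟩
    rwa [show n - (n - x) = x by omega]

lemma card_reverseCompl {n : ℕ} {D : Finset ℕ} (hD : D ⊆ Finset.Icc 1 (n - 1)) :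
    (reverseCompl n D).card + D.card = n - 1 := by
  rw [reverseCompl, Finset.card_image_of_injOn, Finset.card_sdiff_add_card_eq_card hD]
  · simp
  · intro a ha b hb h
    simp only [Finset.coe_sdiff, Finset.coe_Icc, Set.mem_sdiff, Set.mem_Icc] at ha hb
    simp only at h
    omega

lemma count_mem_eq_card {D : Finset ℕ} {m : ℕ} (hD : ∀ x ∈ D, x < m) :
    Nat.count (· ∈ D) m = D.card := by
  rw [Nat.count_eq_card_filter_range]
  congr 1
  ext x
  simp only [Finset.mem_filter, Finset.mem_range]
  exact ⟨fun h => h.2, fun h => ⟨hD x h, h⟩⟩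

lemma count_reverseCompl {n m : ℕ} {D : Finset ℕ} (hD : D ⊆ Finset.Icc 1 (n - 1)) (hm : m < n) :
    Nat.count (· ∈ reverseCompl n D) (m + 1) + D.card
      = m + Nat.count (· ∈ D) (n - m) := by
  induction m with
  | zero =>
    rw [Nat.count_succ, Nat.count_zero, if_neg (fun h => by
      have := Finset.mem_Icc.1 (mem_reverseCompl.1 h).1; omega), Nat.sub_zero,
      count_mem_eq_card (fun x hx => by have := Finset.mem_Icc.1 (hD hx); omega)]
  | succ m ih =>
    have ih := ih (by omega)
    rw [show n - m = n - (m + 1) + 1 by omega, Nat.count_succ _ (n - (m + 1))] at ih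
    rw [Nat.count_succ _ (m + 1)]
    have key : m + 1 ∈ reverseCompl n D ↔ n - (m + 1) ∉ D := by
      rw [mem_reverseCompl, Finset.mem_Icc]
      exact ⟨fun h => h.2, fun h => ⟨by omega, h⟩⟩
    by_cases h : n - (m + 1) ∈ D
    · simp only [key, h, not_true_eq_false, if_true, if_false] at ih ⊢
      omega
    · simp only [key, h, not_false_eq_true, if_true, if_false] at ih ⊢
      omega

lemma reverseCompl_mem_galeBelow {n : ℕ} {D X : Finset ℕ}
    (hD : D ⊆ Finset.Icc 1 (n - 1)) (hX : X ∈ galeBelow n D) :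
    reverseCompl n X ∈ galeBelow n (reverseCompl n D) := by
  simp only [galeBelow, Finset.mem_filter, Finset.mem_powerset] at hX ⊢
  obtain ⟨hXs, hc, hle⟩ := hX
  have h1 := card_reverseCompl hD
  have h2 := card_reverseCompl hXs
  refine ⟨reverseCompl_subset n X, by omega, fun m hm => ?_⟩
  rcases m with _ | m
  · simp
  have h3 := count_reverseCompl hD hm
  have h4 := count_reverseCompl hXs hm
  have h5 := hle (n - m) (by omega)
  omega

lemma card_galeBelow_reverseCompl {n : ℕ} {D : Finset ℕ} (hD : D ⊆ Finset.Icc 1 (n - 1)) :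
    (galeBelow n D).card = (galeBelow n (reverseCompl n D)).card := by
  refine Finset.card_nbij' (reverseCompl n) (reverseCompl n) ?_ ?_ ?_ ?_
  · exact fun X hX => reverseCompl_mem_galeBelow hD hX
  · intro X hX
    have := reverseCompl_mem_galeBelow (reverseCompl_subset n D) hX
    rwa [reverseCompl_reverseCompl hD] at this
  · intro X hX
    exact reverseCompl_reverseCompl (Finset.mem_powerset.1 (Finset.mem_filter.1 hX).1)
  · intro X hX
    exact reverseCompl_reverseCompl (Finset.mem_powerset.1 (Finset.mem_filter.1 hX).1)

lemma count_image_eq_count_changeSet {n : ℕ} {F : ℕ → ℕ} (hF : MonotoneOn F (Set.Iio n))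
    (h0 : F 0 = 0) {i : ℕ} (hi : i < n) :
    Nat.count (· ∈ (Finset.range n).image F) (F i) = Nat.count (· ∈ changeSet n F) (i + 1) := by
  induction i with
  | zero =>
    rw [h0, Nat.count_succ]
    simp [changeSet]
  | succ i ih =>
    have ih := ih (by omega)
    rw [Nat.count_succ, ← ih]
    have hle : F i ≤ F (i + 1) := hF (show i < n by omega) hi (by omega)
    by_cases h : F i = F (i + 1)
    · rw [if_neg, h, add_zero]
      simp [changeSet, h]
    · rw [if_pos]
      · have hlt : F i < F (i + 1) := by omega
        obtain ⟨d, hd⟩ := Nat.exists_eq_add_of_lt hlt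
        rw [hd, show F i + d + 1 = F i + 1 + d by omega, Nat.count_add, Nat.count_succ, if_pos]
        · rw [Nat.add_eq_left, Nat.count_iff_forall_not]
          intro k hk hmem
          obtain ⟨j, hj, hjk⟩ := Finset.mem_image.1 hmem
          rw [Finset.mem_range] at hj
          rcases Nat.lt_or_ge i j with hij | hij
          · have : F (i + 1) ≤ F j := hF hi hj hij
            omega
          · have : F j ≤ F i := hF hj (show i < n by omega) hij
            omega
        · exact Finset.mem_image_of_mem _ (Finset.mem_range.2 (by omega))
      · simp only [changeSet, Finset.mem_filter, Finset.mem_Icc, Nat.add_sub_cancel]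
        exact ⟨by omega, h⟩

lemma card_image_eq_card_changeSet {n : ℕ} (hn : 1 ≤ n) {F : ℕ → ℕ}
    (hF : MonotoneOn F (Set.Iio n)) (h0 : F 0 = 0) :
    ((Finset.range n).image F).card = (changeSet n F).card + 1 := by
  have h := count_image_eq_count_changeSet hF h0 (i := n - 1) (by omega)
  rw [count_mem_eq_card (D := changeSet n F) (fun x hx => by
    have := Finset.mem_Icc.1 (Finset.mem_filter.1 hx).1; omega)] at h
  rw [← h, ← count_mem_eq_card (m := F (n - 1) + 1), Nat.count_succ, if_pos]
  · exact Finset.mem_image_of_mem _ (Finset.mem_range.2 (by omega))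
  · intro x hx
    obtain ⟨j, hj, rfl⟩ := Finset.mem_image.1 hx
    rw [Finset.mem_range] at hj
    exact Nat.lt_succ_of_le (hF hj (show n - 1 < n by omega) (by omega))

lemma count_erase_zero {A : Finset ℕ} (hA : 0 ∈ A) (m : ℕ) :
    Nat.count (· ∈ A.erase 0) (m + 1) + 1 = Nat.count (· ∈ A) (m + 1) := by
  simp only [Nat.count_succ', hA, if_true]
  simp

lemma image_erase_zero_mem_galeBelow {n : ℕ} (hn : 1 ≤ n) {F : ℕ → ℕ}
    (hF : MonotoneOn F (Set.Iio n)) (hp : ∀ i < n, F i ≤ i) :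
    ((Finset.range n).image F).erase 0 ∈ galeBelow n (changeSet n F) := by
  have h0 : F 0 = 0 := Nat.le_zero.1 (hp 0 hn)
  have hmem : 0 ∈ (Finset.range n).image F :=
    Finset.mem_image.2 ⟨0, Finset.mem_range.2 hn, h0⟩
  simp only [galeBelow, Finset.mem_filter, Finset.mem_powerset]
  refine ⟨fun x hx => ?_, ?_, fun m hm => ?_⟩
  · obtain ⟨hx0, hx⟩ := Finset.mem_erase.1 hx
    obtain ⟨j, hj, rfl⟩ := Finset.mem_image.1 hx
    rw [Finset.mem_range] at hj
    have := hp j hj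
    rw [Finset.mem_Icc]
    omega
  · rw [Finset.card_erase_of_mem hmem, card_image_eq_card_changeSet hn hF h0]
    simp
  · rcases m with _ | m
    · simp
    have h1 := count_erase_zero hmem m
    have h2 := count_image_eq_count_changeSet hF h0 hm
    have h3 : Nat.count (· ∈ (Finset.range n).image F) (F m + 1) ≤
        Nat.count (· ∈ (Finset.range n).image F) (m + 1) :=
      Nat.count_monotone _ (by have := hp m hm; omega)
    rw [Nat.count_succ, if_pos (Finset.mem_image_of_mem _ (Finset.mem_range.2 hm))] at h3
    omega

/-- The word with change set `D` whose letters are the elements of `A`. -/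
noncomputable def wordOf (D A : Finset ℕ) (i : ℕ) : ℕ :=
  Nat.nth (· ∈ A) (Nat.count (· ∈ D) (i + 1))

lemma eq_wordOf {n : ℕ} {F : ℕ → ℕ} (hF : MonotoneOn F (Set.Iio n)) (h0 : F 0 = 0)
    {i : ℕ} (hi : i < n) :
    F i = wordOf (changeSet n F) ((Finset.range n).image F) i := by
  rw [wordOf, ← count_image_eq_count_changeSet hF h0 hi, Nat.nth_count]
  exact Finset.mem_image_of_mem _ (Finset.mem_range.2 hi)

section WordOf

variable {n : ℕ} {D A : Finset ℕ}

lemma count_lt_card (hD : D ⊆ Finset.Icc 1 (n - 1)) (hA : A.card = D.card + 1) {i : ℕ}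
    (hfin : (Set.ofPred (· ∈ A)).Finite) :
    Nat.count (· ∈ D) i < hfin.toFinset.card := by
  have h1 : hfin.toFinset = A := by ext; simp [Set.ofPred]
  have h2 : Nat.count (· ∈ D) i ≤ Nat.count (· ∈ D) (max i n) :=
    Nat.count_monotone _ (le_max_left _ _)
  rw [count_mem_eq_card (m := max i n)] at h2
  · rw [h1]
    omega
  · intro x hx
    have := Finset.mem_Icc.1 (hD hx)
    omega

lemma wordOf_mem (hD : D ⊆ Finset.Icc 1 (n - 1)) (hA : A.card = D.card + 1) (i : ℕ) :
    wordOf D A i ∈ A :=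
  Nat.nth_mem (p := (· ∈ A)) _ fun hfin => count_lt_card hD hA hfin

lemma wordOf_monotone (hD : D ⊆ Finset.Icc 1 (n - 1)) (hA : A.card = D.card + 1) :
    Monotone (wordOf D A) := by
  intro i j hij
  have hfin : (Set.ofPred (· ∈ A)).Finite := A.finite_toSet
  exact Nat.nth_le_nth' (Nat.count_monotone _ (by omega)) fun h => count_lt_card hD hA h

lemma wordOf_le {i : ℕ} (h : Nat.count (· ∈ D) (i + 1) < Nat.count (· ∈ A) (i + 1)) :
    wordOf D A i ≤ i :=
  Nat.le_of_lt_succ (Nat.nth_lt_of_lt_count h)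

lemma changeSet_wordOf (hD : D ⊆ Finset.Icc 1 (n - 1)) (hA : A.card = D.card + 1) :
    changeSet n (wordOf D A) = D := by
  have hfin : (Set.ofPred (· ∈ A)).Finite := A.finite_toSet
  have key : ∀ i, wordOf D A i ≠ wordOf D A (i + 1) ↔ i + 1 ∈ D := by
    intro i
    rw [not_iff_comm]
    constructor
    · intro h
      rw [wordOf, wordOf, Nat.count_succ _ (i + 1), if_neg h, add_zero]
    · intro h h'
      have := Nat.nth_injOn hfin (count_lt_card hD hA hfin) (count_lt_card hD hA hfin) h
      rw [Nat.count_succ _ (i + 1), if_pos h'] at this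
      omega
  ext x
  simp only [changeSet, Finset.mem_filter]
  constructor
  · rintro ⟨hx, h⟩
    obtain ⟨i, rfl⟩ : ∃ i, x = i + 1 := ⟨x - 1, by have := Finset.mem_Icc.1 hx; omega⟩
    exact (key i).1 h
  · intro hx
    refine ⟨hD hx, ?_⟩
    obtain ⟨i, rfl⟩ : ∃ i, x = i + 1 := ⟨x - 1, by have := Finset.mem_Icc.1 (hD hx); omega⟩
    exact (key i).2 hx

lemma image_wordOf (hn : 1 ≤ n) (hD : D ⊆ Finset.Icc 1 (n - 1)) (hA : A.card = D.card + 1)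
    (h0 : wordOf D A 0 = 0) :
    (Finset.range n).image (wordOf D A) = A := by
  refine Finset.eq_of_subset_of_card_le (fun x hx => ?_) ?_
  · obtain ⟨j, -, rfl⟩ := Finset.mem_image.1 hx
    exact wordOf_mem hD hA j
  · rw [card_image_eq_card_changeSet hn ((wordOf_monotone hD hA).monotoneOn _) h0,
      changeSet_wordOf hD hA, hA]

end WordOf

/-- A word on `Fin n` as a function on `ℕ`, extended by `0`. -/
def extendWord {n : ℕ} (f : Fin n → Fin n) (i : ℕ) : ℕ :=
  if h : i < n then f ⟨i, h⟩ else 0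

lemma extendWord_of_lt {n : ℕ} (f : Fin n → Fin n) {i : ℕ} (h : i < n) :
    extendWord f i = f ⟨i, h⟩ := dif_pos h

lemma extendWord_val {n : ℕ} (f : Fin n → Fin n) (i : Fin n) : extendWord f i = f i :=
  extendWord_of_lt f i.2

lemma mem_NDPFset {n : ℕ} {f : Fin n → Fin n} :
    f ∈ NDPFset n ↔ MonotoneOn (extendWord f) (Set.Iio n) ∧ ∀ i < n, extendWord f i ≤ i := by
  simp only [NDPFset, Finset.mem_filter, Finset.mem_univ, true_and]
  refine and_congr ⟨fun h i hi j hj hij => ?_, fun h i j hij => ?_⟩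
    ⟨fun h i hi => ?_, fun h i => ?_⟩
  · rw [extendWord_of_lt f hi, extendWord_of_lt f hj]
    exact h (Fin.mk_le_mk.2 hij)
  · have := h i.2 j.2 hij
    rwa [extendWord_val, extendWord_val] at this
  · rw [extendWord_of_lt f hi]
    simpa using h ⟨i, hi⟩
  · have := h i i.2
    rw [extendWord_val] at this
    omega

lemma changeSet_congr {n : ℕ} {F G : ℕ → ℕ} (h : ∀ i < n, F i = G i) :
    changeSet n F = changeSet n G := by
  ext x
  simp only [changeSet, Finset.mem_filter, Finset.mem_Icc]
  refine and_congr_right fun hx => ?_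
  rw [h x (by omega), h (x - 1) (by omega)]

lemma card_filter_changeSet {n : ℕ} (hn : 1 ≤ n) {D : Finset ℕ}
    (hD : D ⊆ Finset.Icc 1 (n - 1)) :
    ((NDPFset n).filter fun f => changeSet n (extendWord f) = D).card = (galeBelow n D).card := by
  refine Finset.card_bij
    (fun f _ => ((Finset.range n).image (extendWord f)).erase 0) ?_ ?_ ?_
  · intro f hf
    obtain ⟨hfn, rfl⟩ := Finset.mem_filter.1 hf
    obtain ⟨hm, hp⟩ := mem_NDPFset.1 hfn
    exact image_erase_zero_mem_galeBelow hn hm hp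
  · intro f hf g hg h
    obtain ⟨hf, hfD⟩ := Finset.mem_filter.1 hf
    obtain ⟨hg, hgD⟩ := Finset.mem_filter.1 hg
    obtain ⟨hfm, hfp⟩ := mem_NDPFset.1 hf
    obtain ⟨hgm, hgp⟩ := mem_NDPFset.1 hg
    have hf0 := Nat.le_zero.1 (hfp 0 hn)
    have hg0 := Nat.le_zero.1 (hgp 0 hn)
    have him : (Finset.range n).image (extendWord f) = (Finset.range n).image (extendWord g) := by
      rw [← Finset.insert_erase (Finset.mem_image.2 ⟨0, Finset.mem_range.2 hn, hf0⟩),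
        ← Finset.insert_erase (Finset.mem_image.2 ⟨0, Finset.mem_range.2 hn, hg0⟩)]
      exact congrArg (insert 0) h
    funext i
    apply Fin.ext
    rw [← extendWord_val, ← extendWord_val, eq_wordOf hfm hf0 i.2, eq_wordOf hgm hg0 i.2,
      hfD, hgD, him]
  · intro X hX
    simp only [galeBelow, Finset.mem_filter, Finset.mem_powerset] at hX
    obtain ⟨hXs, hc, hle⟩ := hX
    have h0X : 0 ∉ X := fun h => by have := Finset.mem_Icc.1 (hXs h); omega
    have hA : (insert 0 X).card = D.card + 1 := by rw [Finset.card_insert_of_notMem h0X, hc]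
    have hp : ∀ i < n, wordOf D (insert 0 X) i ≤ i := by
      intro i hi
      apply wordOf_le
      rw [← count_erase_zero (Finset.mem_insert_self 0 X), Finset.erase_insert h0X]
      exact Nat.lt_succ_of_le (hle (i + 1) hi)
    have h0 := Nat.le_zero.1 (hp 0 hn)
    let f : Fin n → Fin n := fun i =>
      ⟨wordOf D (insert 0 X) i, (hp i i.2).trans_lt i.2⟩
    have hfe : ∀ i < n, extendWord f i = wordOf D (insert 0 X) i :=
      fun i hi => extendWord_of_lt f hi
    refine ⟨f, Finset.mem_filter.2 ⟨mem_NDPFset.2 ⟨?_, ?_⟩, ?_⟩, ?_⟩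
    · intro i hi j hj hij
      rw [hfe i hi, hfe j hj]
      exact wordOf_monotone hD hA hij
    · intro i hi
      rw [hfe i hi]
      exact hp i hi
    · rw [changeSet_congr hfe, changeSet_wordOf hD hA]
    · rw [Finset.image_congr (g := wordOf D (insert 0 X))
        (fun i hi => hfe i (Finset.mem_range.1 hi)), image_wordOf hn hD hA h0,
        Finset.erase_insert h0X]

/-- The set of sums of prefixes of a list. -/
def prefixSums (L : List ℕ) : Set ℕ := {s | ∃ k, (L.take k).sum = s}

lemma zero_mem_prefixSums (L : List ℕ) : 0 ∈ prefixSums L := ⟨0, by simp⟩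

lemma mem_prefixSums_cons {x s : ℕ} {L : List ℕ} :
    s ∈ prefixSums (x :: L) ↔ s = 0 ∨ ∃ t ∈ prefixSums L, x + t = s := by
  constructor
  · rintro ⟨_ | k, rfl⟩
    · simp
    · exact Or.inr ⟨_, ⟨k, rfl⟩, by simp⟩
  · rintro (rfl | ⟨_, ⟨k, rfl⟩, rfl⟩)
    · exact zero_mem_prefixSums _
    · exact ⟨k + 1, by simp⟩

lemma prefixSums_filter_ne_zero (L : List ℕ) :
    prefixSums (L.filter (· ≠ 0)) = prefixSums L := by
  induction L with
  | nil => rfl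
  | cons x L ih =>
    ext s
    rcases Nat.eq_zero_or_pos x with rfl | hx
    · rw [List.filter_cons_of_neg (by simp), ih, mem_prefixSums_cons]
      constructor
      · exact fun h => Or.inr ⟨s, h, by simp⟩
      · rintro (rfl | ⟨t, ht, rfl⟩)
        · exact zero_mem_prefixSums _
        · simpa using ht
    · rw [List.filter_cons_of_pos (by simpa using hx.ne'), mem_prefixSums_cons,
        mem_prefixSums_cons, ih]

lemma prefixSums_injective {L M : List ℕ} (hL : ∀ x ∈ L, 0 < x) (hM : ∀ x ∈ M, 0 < x)
    (h : prefixSums L = prefixSums M) : L = M := by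
  have hnil : ∀ {x : ℕ} {N : List ℕ}, 0 < x → prefixSums (x :: N) ≠ prefixSums [] := by
    intro x N hx h
    have : x ∈ prefixSums (x :: N) :=
      mem_prefixSums_cons.2 (Or.inr ⟨0, zero_mem_prefixSums _, by simp⟩)
    rw [h] at this
    obtain ⟨k, hk⟩ := this
    simp at hk
    omega
  induction L generalizing M with
  | nil =>
    cases M with
    | nil => rfl
    | cons y M => exact absurd h.symm (hnil (hM y (by simp)))
  | cons x L ih =>
    cases M with
    | nil => exact absurd h (hnil (hL x (by simp)))
    | cons y M =>
      have hx := hL x (by simp)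
      have hy := hM y (by simp)
      have head_le : ∀ {a b : ℕ} {A B : List ℕ}, 0 < a →
          prefixSums (a :: A) = prefixSums (b :: B) → b ≤ a := by
        intro a b A B ha hAB
        have : a ∈ prefixSums (a :: A) :=
          mem_prefixSums_cons.2 (Or.inr ⟨0, zero_mem_prefixSums _, by simp⟩)
        rw [hAB, mem_prefixSums_cons] at this
        rcases this with h | ⟨t, -, h⟩ <;> omega
      obtain rfl : x = y := le_antisymm (head_le hy h.symm) (head_le hx h)
      have tail_subset : ∀ {A B : List ℕ},
          prefixSums (x :: A) = prefixSums (x :: B) → prefixSums A ⊆ prefixSums B := by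
        intro A B hAB s hs
        have : x + s ∈ prefixSums (x :: A) := mem_prefixSums_cons.2 (Or.inr ⟨s, hs, rfl⟩)
        rw [hAB, mem_prefixSums_cons] at this
        rcases this with h | ⟨t, ht, h⟩
        · omega
        · rwa [show s = t by omega]
      rw [ih (fun z hz => hL z (by simp [hz])) (fun z hz => hM z (by simp [hz]))
        (Set.Subset.antisymm (tail_subset h) (tail_subset h.symm))]

lemma mem_descents_iff {n : ℕ} (I : Composition n) {s : ℕ} :
    s ∈ descents I ↔ s ∈ Finset.Icc 1 (n - 1) ∧ s ∈ prefixSums I.blocks := by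
  simp only [descents, Finset.mem_image, Finset.mem_range, Finset.mem_Icc]
  constructor
  · rintro ⟨j, hj, rfl⟩
    refine ⟨?_, j + 1, rfl⟩
    have h1 : I.sizeUpTo j < I.sizeUpTo (j + 1) := I.sizeUpTo_strict_mono (by omega)
    have h2 : I.sizeUpTo (j + 1) < I.sizeUpTo (j + 1 + 1) := I.sizeUpTo_strict_mono (by omega)
    have h3 := I.sizeUpTo_le (j + 1 + 1)
    change 1 ≤ I.sizeUpTo (j + 1) ∧ I.sizeUpTo (j + 1) ≤ n - 1
    omega
  · rintro ⟨hs, k, rfl⟩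
    change 1 ≤ I.sizeUpTo k ∧ I.sizeUpTo k ≤ n - 1 at hs
    have hk0 : k ≠ 0 := by
      rintro rfl
      simp at hs
    have hk : k < I.length := by
      by_contra hk
      rw [I.sizeUpTo_ofLength_le k (by omega)] at hs
      omega
    exact ⟨k - 1, by omega, by rw [Nat.sub_add_cancel (by omega)]⟩

lemma descents_subset {n : ℕ} (I : Composition n) : descents I ⊆ Finset.Icc 1 (n - 1) :=
  fun _ h => ((mem_descents_iff I).1 h).1

lemma prefixSums_blocks {n : ℕ} (I : Composition n) :
    prefixSums I.blocks = insert 0 (insert n (descents I : Set ℕ)) := by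
  ext s
  simp only [Set.mem_insert_iff, Finset.mem_coe, mem_descents_iff, Finset.mem_Icc]
  constructor
  · intro h
    have hle : s ≤ n := by
      obtain ⟨k, rfl⟩ := h
      exact I.sizeUpTo_le k
    by_cases h0 : s = 0
    · exact Or.inl h0
    by_cases hs : s = n
    · exact Or.inr (Or.inl hs)
    exact Or.inr (Or.inr ⟨by omega, h⟩)
  · rintro (rfl | rfl | h)
    · exact zero_mem_prefixSums _
    · exact ⟨I.length, I.sizeUpTo_length⟩
    · exact h.2

lemma mem_prefixSums_pEv {n : ℕ} (f : Fin n → Fin n) {s : ℕ} :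
    s ∈ prefixSums (pEv f) ↔
      ∃ k ≤ n, (Finset.univ.filter fun j => (f j : ℕ) < k).card = s := by
  have key : ∀ k ≤ n, (((List.range n).map fun a =>
      (Finset.univ.filter fun j => (f j : ℕ) = a).card).take k).sum =
      (Finset.univ.filter fun j => (f j : ℕ) < k).card := by
    intro k hk
    rw [← List.map_take, List.take_range, min_eq_left hk,
      Finset.card_eq_sum_card_fiberwise (f := fun j => (f j : ℕ)) (t := Finset.range k)
        (fun j hj => by simpa using hj)]
    change ∑ a ∈ Finset.range k, _ = _
    refine Finset.sum_congr rfl fun a ha => ?_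
    rw [Finset.filter_filter]
    congr 1
    refine Finset.filter_congr fun j _ => ?_
    have := Finset.mem_range.1 ha
    omega
  rw [pEv, prefixSums_filter_ne_zero]
  constructor
  · rintro ⟨k, rfl⟩
    refine ⟨min k n, min_le_right _ _, ?_⟩
    rw [← key _ (min_le_right _ _)]
    rcases le_total k n with h | h
    · rw [min_eq_left h]
    · rw [min_eq_right h, List.take_of_length_le (by simp), List.take_of_length_le (by simpa)]
  · rintro ⟨k, hk, rfl⟩
    exact ⟨k, key k hk⟩

lemma prefixSums_pEv {n : ℕ} (hn : 1 ≤ n) {f : Fin n → Fin n} (hf : f ∈ NDPFset n) :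
    prefixSums (pEv f) = insert 0 (insert n (changeSet n (extendWord f) : Set ℕ)) := by
  obtain ⟨hm, -⟩ := mem_NDPFset.1 hf
  have card_eq : ∀ c ≤ n, ∀ k, (∀ i < n, extendWord f i < k ↔ i < c) →
      (Finset.univ.filter fun j => (f j : ℕ) < k).card = c := by
    intro c hc k h
    refine Eq.trans ?_ (Fin.card_filter_val_lt.trans (min_eq_right hc))
    congr 1
    refine Finset.filter_congr fun j _ => ?_
    rw [← extendWord_val, h j j.2]
  ext s
  simp only [mem_prefixSums_pEv, Set.mem_insert_iff, Finset.mem_coe, changeSet,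
    Finset.mem_filter, Finset.mem_Icc]
  constructor
  · rintro ⟨k, hk, rfl⟩
    by_cases hall : ∀ i < n, extendWord f i < k
    · exact Or.inr (Or.inl (card_eq n le_rfl k fun i hi => by simp [hi, hall i hi]))
    push Not at hall
    obtain ⟨hc, hck⟩ := Nat.find_spec hall
    set c := Nat.find hall with hc_def
    have hmin : ∀ i < c, extendWord f i < k := fun i hi => by
      have := Nat.find_min hall hi
      push Not at this
      exact this (hi.trans hc)
    rw [card_eq c hc.le k fun i hi => ⟨fun h => ?_, hmin i⟩]
    · rcases Nat.eq_zero_or_pos c with h | h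
      · exact Or.inl h
      · refine Or.inr (Or.inr ⟨by omega, ?_⟩)
        have := hmin (c - 1) (by omega)
        omega
    · by_contra hic
      have : extendWord f c ≤ extendWord f i := hm hc hi (by omega)
      omega
  · rintro (rfl | rfl | ⟨hs, hne⟩)
    · exact ⟨0, Nat.zero_le _, by simp⟩
    · exact ⟨s, le_rfl, card_eq s le_rfl s fun i hi => by simp [extendWord_of_lt f hi, hi]⟩
    · have hsn : s < n := by omega
      refine ⟨extendWord f s, ?_, card_eq s hsn.le _ fun i hi => ⟨fun h => ?_, fun h => ?_⟩⟩
      · rw [extendWord_of_lt f hsn]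
        exact (f _).2.le
      · by_contra his
        have : extendWord f s ≤ extendWord f i := hm hsn hi (by omega)
        omega
      · have h1 : extendWord f i ≤ extendWord f (s - 1) :=
          hm hi (show s - 1 < n by omega) (by omega)
        have h2 : extendWord f (s - 1) ≤ extendWord f s :=
          hm (show s - 1 < n by omega) hsn (by omega)
        omega

lemma pEv_eq_blocks_iff {n : ℕ} (hn : 1 ≤ n) {f : Fin n → Fin n} (hf : f ∈ NDPFset n)
    (I : Composition n) :
    pEv f = I.blocks ↔ changeSet n (extendWord f) = descents I := by
  have hpos : ∀ x ∈ pEv f, 0 < x := fun x hx =>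
    Nat.pos_of_ne_zero (by simpa using (List.mem_filter.1 hx).2)
  constructor
  · intro h
    ext x
    have hx : x ∈ Finset.Icc 1 (n - 1) → x ≠ 0 ∧ x ≠ n := fun h => by
      have := Finset.mem_Icc.1 h
      omega
    have h1 := congrArg (x ∈ prefixSums ·) h
    simp only [prefixSums_pEv hn hf, prefixSums_blocks, Set.mem_insert_iff, Finset.mem_coe,
      eq_iff_iff] at h1
    constructor
    · intro hm
      have := hx (Finset.mem_filter.1 hm).1
      tauto
    · intro hm
      have := hx (descents_subset I hm)
      tauto
  · intro h
    refine prefixSums_injective hpos (fun x hx => I.blocks_pos hx) ?_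
    rw [prefixSums_pEv hn hf, prefixSums_blocks, h]

/-- If `J` is the conjugate composition `I∼` of `I`, i.e. the (unique)
composition of `n` whose descent set is `{n - d : d ∈ {1,…,n-1} \ D(I)}`, then
`I` and `J` have the same number of nondecreasing parking functions with that
packed evaluation. -/
theorem stmt5 (n : ℕ) (hn : 1 ≤ n) (I J : Composition n)
    (hJ : descents J = ((Finset.Icc 1 (n - 1)) \ descents I).image fun d => n - d) :
    ((NDPFset n).filter fun f => pEv f = I.blocks).card =
      ((NDPFset n).filter fun f => pEv f = J.blocks).card := by
  have key : ∀ K : Composition n,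
      ((NDPFset n).filter fun f => pEv f = K.blocks).card = (galeBelow n (descents K)).card := by
    intro K
    rw [← card_filter_changeSet hn (descents_subset K)]
    exact congrArg Finset.card
      (Finset.filter_congr fun f hf => pEv_eq_blocks_iff hn hf K)
  rw [key I, key J, hJ]
  exact card_galeBelow_reverseCompl (descents_subset I)
end

section
/- For all integers n ≥ 1 and r ≥ 1, the number of r-parking functions of length n is |PF_n^{(r)}| = r(r+n)^{n−1}. -/
open Finset

open scoped Classical in
/-- The set of `r`-parking functions of length `n`: words over the positive
integers whose nondecreasing rearrangement satisfies `a↑ᵢ ≤ i + r - 1`.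
Since all letters are then at most `n + r - 1`, they are encoded as functions
`f : Fin n → Fin (n + r - 1)`, `f j` representing the letter `(f j : ℕ) + 1`;
the condition reads `(sorted f) i + 1 ≤ (i + 1) + r - 1`, i.e.
`((f ∘ Tuple.sort f) i : ℕ) < i + r`. -/
noncomputable def rPFset (n r : ℕ) : Finset (Fin n → Fin (n + r - 1)) :=
  Finset.univ.filter fun f =>
    ∀ i : Fin n, ((f ∘ Tuple.sort f) i : ℕ) < (i : ℕ) + r

/-- The rearrangement-free form of the `r`-parking condition, for words with nonnegative letters
indexed by an arbitrary finite type. -/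
def IsRParking {α : Type*} [Fintype α] (r : ℕ) (f : α → ℕ) : Prop :=
  ∀ k < Fintype.card α, k < #{j | f j < k + r}

namespace IsRParking

variable {α : Type*} [Fintype α] {r : ℕ}

theorem lt {f : α → ℕ} (hf : IsRParking r f) (j : α) : f j < Fintype.card α + r - 1 := by
  have hpos : 0 < Fintype.card α := Fintype.card_pos_iff.2 ⟨j⟩
  have h := hf (Fintype.card α - 1) (by omega)
  have huniv : ({j | f j < Fintype.card α - 1 + r} : Finset α) = univ := by
    rw [← Finset.card_eq_iff_eq_univ]
    have := Finset.card_le_univ ({j | f j < Fintype.card α - 1 + r} : Finset α)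
    omega
  have hj := Finset.mem_univ j
  rw [← huniv, Finset.mem_filter] at hj
  omega

instance finite : Finite {f : α → ℕ // IsRParking r f} := by
  refine Finite.of_injective
    (fun f j => (⟨f.1 j, f.2.lt j⟩ : Fin (Fintype.card α + r - 1))) fun f g h => ?_
  ext j
  simpa using congrFun h j

end IsRParking

section Support

variable {α : Type*} [Fintype α] [DecidableEq α]

/-- Raise every letter of a word on `S` by one and extend it by zero. -/
def succExtend (S : Finset α) (g : S → ℕ) (x : α) : ℕ :=
  if h : x ∈ S then g ⟨x, h⟩ + 1 else 0

theorem card_succExtend_lt (S : Finset α) (g : S → ℕ) (m : ℕ) :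
    #{j | succExtend S g j < m + 1} = #Sᶜ + #{x : S | g x < m} := by
  have hS : #{x : S | g x < m} = ∑ x ∈ S, if succExtend S g x < m + 1 then 1 else 0 := by
    rw [Finset.card_filter, ← Finset.sum_coe_sort S]
    refine Finset.sum_congr rfl fun x _ => ?_
    simp [succExtend]
  have hc : #Sᶜ = ∑ x ∈ Sᶜ, if succExtend S g x < m + 1 then 1 else 0 := by
    rw [Finset.card_eq_sum_ones]
    refine Finset.sum_congr rfl fun x hx => ?_
    simp [succExtend, Finset.mem_compl.1 hx]
  rw [hS, hc, Finset.card_filter, Finset.sum_compl_add_sum]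

theorem isRParking_succExtend_iff (r : ℕ) (S : Finset α) (g : S → ℕ) :
    IsRParking (r + 1) (succExtend S g) ↔ IsRParking (r + #Sᶜ) g := by
  have hcard : Fintype.card α = #S + #Sᶜ := (Finset.card_add_card_compl S).symm
  simp only [IsRParking, ← add_assoc, card_succExtend_lt, Fintype.card_coe, hcard]
  constructor
  · intro h k hk
    have := h (k + #Sᶜ) (by omega)
    rw [add_right_comm] at this
    omega
  · intro h k hk
    rcases lt_or_ge k #Sᶜ with hlt | hge
    · omega
    · obtain ⟨m, rfl⟩ := Nat.exists_eq_add_of_le' hge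
      have := h m (by omega)
      rw [add_right_comm] at this
      omega

/-- An `(r + 1)`-parking function is determined by its support and its restriction to it. -/
noncomputable def rParkingSuccEquiv (r : ℕ) :
    (Σ S : Finset α, {g : S → ℕ // IsRParking (r + #Sᶜ) g}) ≃
      {f : α → ℕ // IsRParking (r + 1) f} :=
  Equiv.ofBijective
    (fun p => ⟨succExtend p.1 p.2.1, (isRParking_succExtend_iff r p.1 p.2.1).2 p.2.2⟩) <| by
    constructor
    · rintro ⟨S, g, hg⟩ ⟨T, h, hh⟩ heq
      have heq' : succExtend S g = succExtend T h := congrArg Subtype.val heq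
      obtain rfl : S = T := by
        ext x
        have hx := congrFun heq' x
        unfold succExtend at hx
        split_ifs at hx <;> simp_all
      obtain rfl : g = h := by
        funext x
        simpa [succExtend] using congrFun heq' x
      rfl
    · rintro ⟨f, hf⟩
      have hext : succExtend ({x | f x ≠ 0} : Finset α) (fun x => f x - 1) = f := by
        funext x
        by_cases hx : f x = 0
        · simp [succExtend, hx]
        · simp [succExtend, hx, Nat.sub_add_cancel (Nat.pos_of_ne_zero hx)]
      refine ⟨⟨({x | f x ≠ 0} : Finset α), fun x => f x - 1, ?_⟩, Subtype.ext hext⟩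
      rwa [← isRParking_succExtend_iff, hext]

end Support

theorem sum_choose_mul_pow_sub (n : ℕ) (x : ℤ) :
    ∑ m ∈ range (n + 1), (n.choose m : ℤ) * (x ^ m - m * x ^ (m - 1)) =
      (x + 1) ^ n - n * (x + 1) ^ (n - 1) := by
  simp only [mul_sub, Finset.sum_sub_distrib]
  congr 1
  · rw [add_pow]
    exact Finset.sum_congr rfl fun m _ => by ring
  · cases n with
    | zero => simp
    | succ p =>
      rw [Finset.sum_range_succ']
      simp only [Nat.cast_zero, zero_mul, mul_zero, add_zero, Nat.add_sub_cancel]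
      rw [add_pow, Finset.mul_sum]
      refine Finset.sum_congr rfl fun m _ => ?_
      have h : ((p + 1 : ℕ) : ℤ) * (p.choose m : ℤ) =
          ((p + 1).choose (m + 1) : ℤ) * ((m + 1 : ℕ) : ℤ) := by
        exact_mod_cast Nat.add_one_mul_choose_eq p m
      rw [← mul_assoc, ← h]
      ring

theorem card_isRParking (n r : ℕ) (α : Type) [Fintype α] (hα : Fintype.card α = n) :
    (Nat.card {f : α → ℕ // IsRParking r f} : ℤ) =
      ((r + n : ℕ) : ℤ) ^ n - n * ((r + n : ℕ) : ℤ) ^ (n - 1) := by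
  classical
  induction n using Nat.strong_induction_on generalizing r α with
  | _ n ihn =>
  induction r generalizing α with
  | zero =>
    rcases n with _ | n
    · have := Fintype.card_eq_zero_iff.1 hα
      have : Nat.card {f : α → ℕ // IsRParking 0 f} = 1 := by
        rw [Nat.card_eq_one_iff_unique]
        exact ⟨⟨fun f g => Subtype.ext (Subsingleton.elim _ _)⟩,
          ⟨⟨isEmptyElim, by simp [IsRParking]⟩⟩⟩
      rw [this]
      simp
    · have : IsEmpty {f : α → ℕ // IsRParking 0 f} :=
        ⟨fun f => by simpa using f.2 0 (by omega)⟩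
      simp [pow_succ']
  | succ r ihr =>
    rw [← Nat.card_congr (rParkingSuccEquiv r), Nat.card_sigma, Nat.cast_sum]
    have hfiber (S : Finset α) :
        (Nat.card {g : S → ℕ // IsRParking (r + #Sᶜ) g} : ℤ) =
          ((r + n : ℕ) : ℤ) ^ #S - (#S : ℕ) * ((r + n : ℕ) : ℤ) ^ (#S - 1) := by
      have hS : #S + #Sᶜ = n := hα ▸ Finset.card_add_card_compl S
      rcases Nat.eq_zero_or_pos #Sᶜ with h0 | hpos
      · rw [h0, add_zero] at hS
        rw [h0, add_zero, hS]
        exact ihr S (by rw [Fintype.card_coe, hS])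
      · rw [ihn #S (by omega) (r + #Sᶜ) S (Fintype.card_coe S),
          show r + #Sᶜ + #S = r + n by omega]
    rw [Finset.sum_congr rfl fun S _ => hfiber S, ← Finset.powerset_univ,
      Finset.sum_powerset_apply_card
        (fun m => ((r + n : ℕ) : ℤ) ^ m - (m : ℕ) * ((r + n : ℕ) : ℤ) ^ (m - 1)),
      Finset.card_univ, hα]
    simp only [nsmul_eq_mul]
    rw [sum_choose_mul_pow_sub]
    push_cast
    ring

theorem mem_rPFset_iff {n r : ℕ} (f : Fin n → Fin (n + r - 1)) :
    f ∈ rPFset n r ↔ IsRParking r fun j => (f j : ℕ) := by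
  classical
  have hmono : Monotone fun i => ((f ∘ Tuple.sort f) i : ℕ) :=
    Fin.val_strictMono.monotone.comp (Tuple.monotone_sort f)
  have hcard (m : ℕ) :
      #{i | ((f ∘ Tuple.sort f) i : ℕ) < m} = #{j | (f j : ℕ) < m} := by
    simp only [Finset.card_filter, Function.comp_apply]
    exact Equiv.sum_comp (Tuple.sort f) fun j => if (f j : ℕ) < m then 1 else 0
  simp only [rPFset, Finset.mem_filter_univ, IsRParking, Fintype.card_fin]
  rw [Fin.forall_iff]
  refine forall₂_congr fun k hk => ?_
  rw [← hcard]
  exact (Tuple.lt_card_lt_iff_apply_lt_of_monotone (j := ⟨k, hk⟩) (a := k + r) hmono).symm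

theorem card_rPFset (n r : ℕ) :
    (rPFset n r).card = Nat.card {f : Fin n → ℕ // IsRParking r f} := by
  rw [← Nat.card_eq_finsetCard]
  refine Nat.card_congr <| Equiv.ofBijective
    (fun f => ⟨fun j => (f.1 j : ℕ), (mem_rPFset_iff f.1).1 f.2⟩) ⟨fun f g h => ?_, fun f => ?_⟩
  · ext j
    exact congrFun (congrArg Subtype.val h) j
  · have hlt (j : Fin n) : f.1 j < n + r - 1 := by simpa using f.2.lt j
    exact ⟨⟨fun j => ⟨f.1 j, hlt j⟩, (mem_rPFset_iff _).2 f.2⟩, rfl⟩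

theorem stmt7 (n r : ℕ) (hn : 1 ≤ n) (hr : 1 ≤ r) :
    (rPFset n r).card = r * (r + n) ^ (n - 1) := by
  have h := card_isRParking n r (Fin n) (Fintype.card_fin n)
  obtain ⟨p, rfl⟩ := Nat.exists_eq_add_of_le' hn
  rw [card_rPFset]
  zify
  rw [h]
  push_cast [Nat.add_sub_cancel]
  ring
end

section
/- For every integer r ≥ 1, the following identity holds in ℚ[[z]]: (Σ_{n≥0} C_n z^n)^r = Σ_{n≥0} (r/(r+2n)) · C(r+2n, n) · z^n, where C_n is the n-th Catalan number. That is, the generating function of the numbers of nondecreasing r-parking functions of length n is the r-th power of the Catalan generating series. -/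
open PowerSeries

theorem catalanSeries_pow_succ (r : ℕ) :
    catalanSeries ^ (r + 1) = catalanSeries ^ r + catalanSeries ^ (r + 2) * X := by
  calc catalanSeries ^ (r + 1) = catalanSeries ^ r * catalanSeries := pow_succ _ _
    _ = catalanSeries ^ r * (catalanSeries ^ 2 * X + 1) := by rw [catalanSeries_sq_mul_X_add_one]
    _ = catalanSeries ^ r + catalanSeries ^ (r + 2) * X := by ring

theorem coeff_succ_catalanSeries_pow_succ (n r : ℕ) :
    coeff (n + 1) (catalanSeries ^ (r + 1)) =
      coeff (n + 1) (catalanSeries ^ r) + coeff n (catalanSeries ^ (r + 2)) := by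
  rw [catalanSeries_pow_succ, map_add, coeff_succ_mul_X]

theorem coeff_catalanSeries_pow (n r : ℕ) :
    ((r : ℚ) + 2 * n) * (coeff n (catalanSeries ^ r) : ℕ) = r * (r + 2 * n).choose n := by
  induction n generalizing r with
  | zero => simp
  | succ n ihn =>
    induction r with
    | zero => simp [coeff_one]
    | succ r ihr =>
      have h := ihn (r + 2)
      have hm : r + 2 * (n + 1) = r + 2 + 2 * n := by ring
      have hm' : r + 1 + 2 * (n + 1) = r + 2 + 2 * n + 1 := by ring
      have hd := Nat.choose_succ_right_eq (r + 2 + 2 * n) n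
      rw [show r + 2 + 2 * n - n = r + 2 + n by omega] at hd
      rw [coeff_succ_catalanSeries_pow_succ, hm', Nat.choose_succ_succ]
      rw [hm] at ihr
      generalize (r + 2 + 2 * n).choose n = c at *
      rw [Nat.succ_eq_add_one]
      generalize (r + 2 + 2 * n).choose (n + 1) = d at *
      have hd' : (d : ℚ) * (n + 1) = c * (r + 2 + n) := by exact_mod_cast hd
      push_cast at h ihr ⊢
      have hpos : (r : ℚ) + 2 + 2 * n ≠ 0 := by positivity
      apply mul_left_cancel₀ hpos
      linear_combination ((r : ℚ) + 1 + 2 * (n + 1)) * (h + ihr) - 2 * hd'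

theorem stmt10 (r : ℕ) (hr : 1 ≤ r) :
    (PowerSeries.mk fun n => (catalan n : ℚ)) ^ r =
      PowerSeries.mk fun n =>
        ((r : ℚ) / (r + 2 * n)) * ((r + 2 * n).choose n) := by
  have hmap : (PowerSeries.mk fun n => (catalan n : ℚ)) =
      PowerSeries.map (Nat.castRingHom ℚ) catalanSeries := by
    ext n
    simp
  ext n
  have hpos : (r : ℚ) + 2 * n ≠ 0 := by positivity
  rw [hmap, ← map_pow, coeff_map, coeff_mk, div_mul_eq_mul_div, eq_div_iff hpos, mul_comm]
  exact coeff_catalanSeries_pow n r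
end

section
/- For all integers k ≥ 1, l ≥ 1 and r ≥ l, the following identity holds in ℚ[[t]]: (1 + Σ_{n≥1} l(nk+l)^{n−1} t^n/n!) · (Σ_{n≥0} (nk+r−l)^n t^n/n!) = Σ_{n≥0} (nk+r)^n t^n/n!, with the convention 0^0 = 1. In particular, the exponential generating function Σ_{n≥0} |PF_n^{(k,l)}| t^n/n! equals (Σ_{n≥0} (nk+r)^n t^n/n!)/(Σ_{n≥0} (nk+r−l)^n t^n/n!), independently of r. -/
open PowerSeries

/-- The divided Abel power `(X + n * k) ^ n / n!`. -/
noncomputable def dividedAbelPow (k : ℚ) (n : ℕ) : Polynomial ℚ :=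
  Polynomial.C (n.factorial : ℚ)⁻¹ * (Polynomial.X + Polynomial.C (n * k)) ^ n

/-- The divided Abel polynomial `x * (x + n * k) ^ (n - 1) / n!`, with value `1` at `n = 0`. -/
noncomputable def dividedAbel (k x : ℚ) (n : ℕ) : ℚ :=
  (if n = 0 then 1 else x * (n * k + x) ^ (n - 1)) / n.factorial

lemma dividedAbelPow_eval (k y : ℚ) (n : ℕ) :
    (dividedAbelPow k n).eval y = (n * k + y) ^ n / n.factorial := by
  simp [dividedAbelPow, div_eq_inv_mul, add_comm]

lemma dividedAbelPow_zero (k : ℚ) : dividedAbelPow k 0 = 1 := by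
  simp [dividedAbelPow]

lemma derivative_dividedAbelPow_succ (k : ℚ) (n : ℕ) :
    (dividedAbelPow k (n + 1)).derivative =
      (dividedAbelPow k n).comp (Polynomial.X + Polynomial.C k) := by
  have h : ((n + 1).factorial : ℚ)⁻¹ * (n + 1) = (n.factorial : ℚ)⁻¹ := by
    rw [Nat.factorial_succ]
    push_cast
    have := n.factorial_ne_zero
    field_simp
  apply Polynomial.funext
  intro y
  simp [dividedAbelPow, Polynomial.derivative_pow]
  rw [← h]
  ring

lemma sum_antidiagonal_neg_one_pow_mul_pow_eq_zero (k x : ℚ) {m n : ℕ} (h : m < n) :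
    ∑ p ∈ Finset.HasAntidiagonal.antidiagonal n, (-1 : ℚ) ^ p.2 * (p.1 * k + x) ^ m /
      (p.1.factorial * p.2.factorial) = 0 := by
  let P : Polynomial ℚ := (Polynomial.C k * Polynomial.X + Polynomial.C x) ^ m
  have hP : P.natDegree < n := by
    refine lt_of_le_of_lt ?_ h
    simpa only [mul_one] using
      Polynomial.natDegree_pow_le_of_le m (Polynomial.natDegree_linear_le (a := k) (b := x))
  have h0 := congrFun (Polynomial.fwdDiff_iter_eq_zero_of_degree_lt hP) 0
  rw [fwdDiff_iter_eq_sum_shift] at h0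
  rw [Finset.Nat.sum_antidiagonal_eq_sum_range_succ_mk]
  have hn : (n.factorial : ℚ) ≠ 0 := by exact_mod_cast n.factorial_ne_zero
  rw [← mul_right_inj' hn, mul_zero, Finset.mul_sum]
  refine Eq.trans (Finset.sum_congr rfl fun i hi => ?_) h0
  have hi : i ≤ n := Nat.lt_succ_iff.mp (Finset.mem_range.mp hi)
  simp only [P, zsmul_eq_mul]
  push_cast
  rw [Nat.cast_choose ℚ hi]
  simp
  ring

lemma dividedAbel_mul_neg_pow (k x : ℚ) {m i j : ℕ} (h : i + j = m + 1) :
    dividedAbel k x i * ((-(i * k + x)) ^ j / j.factorial) =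
      x * ((-1) ^ j * (i * k + x) ^ m / (i.factorial * j.factorial)) := by
  rw [neg_pow, dividedAbel]
  rcases i with _ | i
  · obtain rfl : j = m + 1 := by omega
    simp
    ring
  · obtain rfl : m = i + j := by omega
    simp only [Nat.add_eq_zero_iff, one_ne_zero, and_false, if_false, Nat.add_sub_cancel, pow_add]
    ring

/-- **Abel's binomial identity**, as an identity of polynomials with divided factorials. -/
theorem sum_antidiagonal_dividedAbel_mul (k x : ℚ) (n : ℕ) :
    ∑ p ∈ Finset.HasAntidiagonal.antidiagonal n, Polynomial.C (dividedAbel k x p.1) * dividedAbelPow k p.2 =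
      (dividedAbelPow k n).comp (Polynomial.X + Polynomial.C x) := by
  induction n with
  | zero => simp [dividedAbelPow_zero, dividedAbel]
  | succ m ih =>
    rw [← sub_eq_zero]
    set D := ∑ p ∈ Finset.HasAntidiagonal.antidiagonal (m + 1),
      Polynomial.C (dividedAbel k x p.1) * dividedAbelPow k p.2 -
      (dividedAbelPow k (m + 1)).comp (Polynomial.X + Polynomial.C x) with hD
    have hder : D.derivative = 0 := by
      rw [hD, Finset.Nat.sum_antidiagonal_succ']
      simp only [Polynomial.derivative_sub, Polynomial.derivative_add, Polynomial.derivative_sum,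
        Polynomial.derivative_C_mul, derivative_dividedAbelPow_succ, dividedAbelPow_zero,
        Polynomial.derivative_comp, Polynomial.derivative_one, Polynomial.derivative_X,
        Polynomial.derivative_C, mul_zero, zero_add, add_zero, one_mul]
      have := congrArg (fun q => q.comp (Polynomial.X + Polynomial.C k)) ih
      simp only [Polynomial.sum_comp, Polynomial.mul_comp, Polynomial.C_comp] at this
      rw [this, sub_eq_zero, Polynomial.comp_assoc, Polynomial.comp_assoc]
      congr 1
      simp
      ring
    have heval : D.eval (-((m + 1) * k + x)) = 0 := by
      simp only [hD, Polynomial.eval_sub, Polynomial.eval_finsetSum, Polynomial.eval_mul,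
        Polynomial.eval_C, Polynomial.eval_comp, Polynomial.eval_add, Polynomial.eval_X,
        dividedAbelPow_eval]
      have hterm : ∀ p ∈ Finset.HasAntidiagonal.antidiagonal (m + 1),
          dividedAbel k x p.1 * ((p.2 * k + -((m + 1) * k + x)) ^ p.2 / p.2.factorial) =
          x * ((-1) ^ p.2 * (p.1 * k + x) ^ m / (p.1.factorial * p.2.factorial)) := by
        intro p hp
        have hp := Finset.HasAntidiagonal.mem_antidiagonal.mp hp
        rw [← dividedAbel_mul_neg_pow k x hp]
        have hp' : (p.1 : ℚ) + p.2 = m + 1 := by exact_mod_cast hp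
        rw [← hp']
        ring
      rw [Finset.sum_congr rfl hterm, ← Finset.mul_sum,
        sum_antidiagonal_neg_one_pow_mul_pow_eq_zero k x (Nat.lt_succ_self m)]
      have : ((m + 1 : ℕ) : ℚ) * k + (-((m + 1) * k + x) + x) = 0 := by
        push_cast
        ring
      rw [this]
      simp
    rw [Polynomial.eq_C_of_derivative_eq_zero hder, Polynomial.eval_C] at heval
    rw [Polynomial.eq_C_of_derivative_eq_zero hder, heval, Polynomial.C_0]

theorem stmt16 (k l r : ℕ) (hk : 1 ≤ k) (hl : 1 ≤ l) (hr : l ≤ r) :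
    (PowerSeries.mk fun n : ℕ =>
        (if n = 0 then 1 else ((l * (n * k + l) ^ (n - 1) : ℕ) : ℚ)) / n.factorial) *
      (PowerSeries.mk fun n : ℕ => (((n * k + r - l) ^ n : ℕ) : ℚ) / n.factorial) =
    PowerSeries.mk fun n : ℕ => (((n * k + r) ^ n : ℕ) : ℚ) / n.factorial := by
  obtain ⟨s, rfl⟩ := Nat.exists_eq_add_of_le hr
  ext n
  have h := congrArg (Polynomial.eval (s : ℚ)) (sum_antidiagonal_dividedAbel_mul k l n)
  simp only [Polynomial.eval_finsetSum, Polynomial.eval_mul, Polynomial.eval_C,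
    Polynomial.eval_comp, Polynomial.eval_add, Polynomial.eval_X, dividedAbelPow_eval,
    dividedAbel] at h
  have hsub (j : ℕ) : j * k + (l + s) - l = j * k + s := by omega
  simp only [PowerSeries.coeff_mul, PowerSeries.coeff_mk, hsub]
  push_cast
  rw [h, add_comm (s : ℚ)]
end
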